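/- arXiv:2501.06593 — 2 statements merged into one kernel-verified Lean document; each statement's English description precedes it below -/
import Mathlib

section
/- Uniform ellipticity of a Finsler norm is equivalent to uniform convexity of its square: given H ∈ C²_loc(ℝ^N \ {0}) satisfying H(ξ) > 0 for ξ ≠ 0 and H(sξ) = |s|H(ξ) for all ξ ≠ 0 and s ∈ ℝ, the following are equivalent: (a) there exists Λ > 0 such that ⟨D²H(ξ)v, v⟩ ≥ Λ|v|² for every ξ with H(ξ) = 1 and every v orthogonal to ∇H(ξ); (b) there exists λ > 0 such that ⟨D²(H²)(ξ)η, η⟩ ≥ λ|η|² for every ξ ∈ ℝ^N \ {0} and every η ∈ ℝ^N. -/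
open scoped RealInnerProductSpace Classical
open Metric Set MeasureTheory

noncomputable section

/-- A positive `1`-homogeneous function on a finite-dimensional space dominates the norm. -/
theorem exists_norm_le_mul_of_homogeneous {E : Type*} [NormedAddCommGroup E]
    [NormedSpace ℝ E] [FiniteDimensional ℝ E] {H : E → ℝ}
    (hhom : ∀ y : E, y ≠ 0 → ∀ s : ℝ, 0 < s → H (s • y) = s * H y)
    (hcont : ContinuousOn H {0}ᶜ) (hpos : ∀ y : E, y ≠ 0 → 0 < H y) :
    ∃ C : ℝ, 0 < C ∧ ∀ y : E, y ≠ 0 → ‖y‖ ≤ C * H y := by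
  have hsub : ∀ y ∈ sphere (0 : E) 1, y ≠ 0 := fun y hy => ne_of_mem_sphere hy one_ne_zero
  obtain ⟨m, hm, hle⟩ := (isCompact_sphere (0 : E) 1).exists_forall_le'
    (hcont.mono hsub) (fun y hy => hpos y (hsub y hy))
  refine ⟨m⁻¹, inv_pos.2 hm, fun y hy => ?_⟩
  have hy' : 0 < ‖y‖ := norm_pos_iff.2 hy
  have h := hle (‖y‖⁻¹ • y) (by simp [norm_smul, hy'.ne'])
  rw [hhom y hy _ (inv_pos.2 hy'), inv_mul_eq_div, le_div_iff₀ hy'] at h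
  rwa [inv_mul_eq_div, le_div_iff₀ hm, mul_comm]

section Homogeneous

variable {E : Type*} [NormedAddCommGroup E] [InnerProductSpace ℝ E] [CompleteSpace E]
  {H : E → ℝ} {x : E}

theorem ContDiffAt.differentiableAt_gradient (h : ContDiffAt ℝ 2 H x) :
    DifferentiableAt ℝ (gradient H) x := by
  have h1 : DifferentiableAt ℝ (fderiv ℝ H) x :=
    (h.fderiv_right (m := 1) (by norm_num)).differentiableAt (by norm_num)
  exact (InnerProductSpace.toDual ℝ E).symm.differentiable.differentiableAt.comp x h1

/-- The Hessian quadratic form of the square of a function. -/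
theorem inner_fderiv_gradient_sq (h : ContDiffAt ℝ 2 H x) (v : E) :
    ⟪fderiv ℝ (gradient fun y => H y ^ 2) x v, v⟫ =
      2 * ⟪gradient H x, v⟫ ^ 2 + 2 * H x * ⟪fderiv ℝ (gradient H) x v, v⟫ := by
  have hev : (gradient fun y => H y ^ 2) =ᶠ[nhds x] fun y => (2 * H y) • gradient H y := by
    filter_upwards [h.eventually (by simp)] with y hy
    refine ext_inner_right ℝ fun w => ?_
    have hd : DifferentiableAt ℝ H y := hy.differentiableAt (by norm_num)
    rw [inner_gradient_left, inner_smul_left, inner_gradient_left,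
      (hd.hasFDerivAt.pow 2).fderiv]
    simp
  have hd : DifferentiableAt ℝ H x := h.differentiableAt (by norm_num)
  have hG : HasFDerivAt (fun y => (2 * H y) • gradient H y) _ x :=
    (hd.hasFDerivAt.const_mul 2).smul h.differentiableAt_gradient.hasFDerivAt
  rw [hev.fderiv_eq, hG.fderiv]
  simp [inner_add_left, inner_smul_left]
  ring

theorem gradient_smul_of_homogeneous
    (hhom : ∀ y : E, y ≠ 0 → ∀ s : ℝ, 0 < s → H (s • y) = s * H y)
    (hx : x ≠ 0) {s : ℝ} (hs : 0 < s) :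
    gradient H (s • x) = gradient H x := by
  have hev : (fun y => H (s • y)) =ᶠ[nhds x] s • H := by
    filter_upwards [isOpen_ne.mem_nhds hx] with y hy using hhom y hy s hs
  have h := hev.fderiv_eq (𝕜 := ℝ)
  rw [fderiv_comp_smul, fderiv_const_smul_field] at h
  rw [gradient, gradient, smul_right_injective _ hs.ne' h]

theorem fderiv_gradient_smul_of_homogeneous
    (hhom : ∀ y : E, y ≠ 0 → ∀ s : ℝ, 0 < s → H (s • y) = s * H y)
    (hx : x ≠ 0) {s : ℝ} (hs : 0 < s) :
    s • fderiv ℝ (gradient H) (s • x) = fderiv ℝ (gradient H) x := by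
  have hev : (fun y => gradient H (s • y)) =ᶠ[nhds x] gradient H := by
    filter_upwards [isOpen_ne.mem_nhds hx] with y hy
      using gradient_smul_of_homogeneous hhom hy hs
  rw [← hev.fderiv_eq, fderiv_comp_smul]

/-- Euler's identity for a `1`-homogeneous function. -/
theorem inner_gradient_self_of_homogeneous
    (hhom : ∀ y : E, y ≠ 0 → ∀ s : ℝ, 0 < s → H (s • y) = s * H y)
    (hx : x ≠ 0) (h : DifferentiableAt ℝ H x) :
    ⟪gradient H x, x⟫ = H x := by
  have hline : HasDerivAt (fun t : ℝ => t • x) x 1 := by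
    simpa using (hasDerivAt_id (1 : ℝ)).smul_const x
  have h1 : HasDerivAt (fun t : ℝ => H (t • x)) (fderiv ℝ H x x) 1 :=
    HasFDerivAt.comp_hasDerivAt 1 (by simpa using h.hasFDerivAt) hline
  have h2 : HasDerivAt (fun t : ℝ => H (t • x)) (H x) 1 := by
    refine HasDerivAt.congr_of_eventuallyEq (f := fun t : ℝ => t * H x)
      (by simpa using (hasDerivAt_id (1 : ℝ)).mul_const (H x)) ?_
    filter_upwards [lt_mem_nhds one_pos] with t ht using hhom x hx t ht
  rw [inner_gradient_left, h1.unique h2]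

theorem fderiv_gradient_self_of_homogeneous
    (hhom : ∀ y : E, y ≠ 0 → ∀ s : ℝ, 0 < s → H (s • y) = s * H y)
    (hx : x ≠ 0) (h : ContDiffAt ℝ 2 H x) :
    fderiv ℝ (gradient H) x x = 0 := by
  have hline : HasDerivAt (fun t : ℝ => t • x) x 1 := by
    simpa using (hasDerivAt_id (1 : ℝ)).smul_const x
  have h1 : HasDerivAt (fun t : ℝ => gradient H (t • x)) (fderiv ℝ (gradient H) x x) 1 :=
    HasFDerivAt.comp_hasDerivAt (l := gradient H) 1
      (by simpa using h.differentiableAt_gradient.hasFDerivAt) hline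
  have h2 : HasDerivAt (fun t : ℝ => gradient H (t • x)) 0 1 := by
    refine HasDerivAt.congr_of_eventuallyEq (hasDerivAt_const 1 (gradient H x)) ?_
    filter_upwards [lt_mem_nhds one_pos] with t ht
      using gradient_smul_of_homogeneous hhom hx ht
  exact h1.unique h2

theorem inner_fderiv_gradient_self_of_homogeneous
    (hhom : ∀ y : E, y ≠ 0 → ∀ s : ℝ, 0 < s → H (s • y) = s * H y)
    (hx : x ≠ 0) (h : ContDiffAt ℝ 2 H x)
    (v : E) : ⟪fderiv ℝ (gradient H) x v, x⟫ = 0 := by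
  have hev : (fun y => ⟪gradient H y, y⟫) =ᶠ[nhds x] H := by
    filter_upwards [isOpen_ne.mem_nhds hx, h.eventually (by simp)] with y hy hy'
      using inner_gradient_self_of_homogeneous hhom hy (hy'.differentiableAt (by norm_num))
  have hd := congrArg (fun L => L v) (hev.fderiv_eq (𝕜 := ℝ))
  simp only [fderiv_inner_apply ℝ h.differentiableAt_gradient differentiableAt_fun_id,
    fderiv_fun_id, ContinuousLinearMap.id_apply, ← inner_gradient_left] at hd
  linarith

/-- Only the component of `η` tangent to the level set of `H` contributes to the Hessian
quadratic form of a `1`-homogeneous `H`. -/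
theorem inner_fderiv_gradient_smul_add_of_homogeneous
    (hhom : ∀ y : E, y ≠ 0 → ∀ s : ℝ, 0 < s → H (s • y) = s * H y)
    (hx : x ≠ 0) (h : ContDiffAt ℝ 2 H x)
    (t : ℝ) (v : E) :
    ⟪fderiv ℝ (gradient H) x (t • x + v), t • x + v⟫ = ⟪fderiv ℝ (gradient H) x v, v⟫ := by
  rw [map_add, map_smul, fderiv_gradient_self_of_homogeneous hhom hx h, smul_zero, zero_add,
    inner_add_right, inner_smul_right, inner_fderiv_gradient_self_of_homogeneous hhom hx h,
    mul_zero, zero_add]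

/-- Ellipticity along level sets gives the uniform convexity of the square on `{H = 1}`. -/
theorem le_inner_fderiv_gradient_sq_of_homogeneous
    (hhom : ∀ y : E, y ≠ 0 → ∀ s : ℝ, 0 < s → H (s • y) = s * H y)
    (hx : x ≠ 0) (h : ContDiffAt ℝ 2 H x) (hH : H x = 1) {C Λ : ℝ} (hC : 0 < C)
    (hΛ : 0 < Λ) (hxC : ‖x‖ ≤ C)
    (hell : ∀ v, ⟪gradient H x, v⟫ = 0 → Λ * ‖v‖ ^ 2 ≤ ⟪fderiv ℝ (gradient H) x v, v⟫)
    (η : E) :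
    min (C⁻¹ ^ 2) Λ * ‖η‖ ^ 2 ≤ ⟪fderiv ℝ (gradient fun y => H y ^ 2) x η, η⟫ := by
  obtain ⟨t, ht⟩ : ∃ t, t = ⟪gradient H x, η⟫ := ⟨_, rfl⟩
  obtain ⟨v, hv⟩ : ∃ v, v = η - t • x := ⟨_, rfl⟩
  have hη : η = t • x + v := by rw [hv]; abel
  have hgv : ⟪gradient H x, v⟫ = 0 := by
    rw [hv, inner_sub_right, inner_smul_right,
      inner_gradient_self_of_homogeneous hhom hx (h.differentiableAt (by norm_num)), hH, ht]
    ring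
  rw [inner_fderiv_gradient_sq h, hH, ← ht, hη,
    inner_fderiv_gradient_smul_add_of_homogeneous hhom hx h]
  have hnorm : ‖t • x + v‖ ^ 2 ≤ 2 * (t ^ 2 * C ^ 2) + 2 * ‖v‖ ^ 2 := by
    have hsum : ‖t • x + v‖ ^ 2 ≤ 2 * (‖t • x‖ ^ 2 + ‖v‖ ^ 2) :=
      (pow_le_pow_left₀ (norm_nonneg _) (norm_add_le _ _) 2).trans add_sq_le
    have htx : ‖t • x‖ ^ 2 ≤ t ^ 2 * C ^ 2 := by
      rw [norm_smul, mul_pow, Real.norm_eq_abs, sq_abs]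
      gcongr
    linarith
  have hnn : 0 ≤ min (C⁻¹ ^ 2) Λ := by positivity
  have h1 : min (C⁻¹ ^ 2) Λ * (t ^ 2 * C ^ 2) ≤ t ^ 2 := by
    calc min (C⁻¹ ^ 2) Λ * (t ^ 2 * C ^ 2) ≤ C⁻¹ ^ 2 * (t ^ 2 * C ^ 2) := by
          gcongr; exact min_le_left _ _
      _ = t ^ 2 := by field_simp
  have h2 : min (C⁻¹ ^ 2) Λ * ‖v‖ ^ 2 ≤ Λ * ‖v‖ ^ 2 := by
    gcongr; exact min_le_right _ _
  have h3 := mul_le_mul_of_nonneg_left hnorm hnn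
  linarith [hell v hgv]

end Homogeneous

/-- Uniform ellipticity of a Finsler norm is equivalent to the uniform convexity of its
square: for a positive, absolutely `1`-homogeneous `H` of class `C²` away from the origin,
there is `Λ > 0` with `⟨D²H(ξ)v, v⟩ ≥ Λ|v|²` for all `ξ` with `H(ξ) = 1` and all
`v ⊥ ∇H(ξ)`, if and only if there is `λ > 0` with `⟨D²(H²)(ξ)η, η⟩ ≥ λ|η|²` for all
`ξ ≠ 0` and all `η`. -/
theorem finsler_uniform_ellipticity_iff_square_convex {N : ℕ} (hN : 2 ≤ N)
    (H : EuclideanSpace ℝ (Fin N) → ℝ)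
    (hreg : ContDiffOn ℝ 2 H {(0 : EuclideanSpace ℝ (Fin N))}ᶜ)
    (hpos : ∀ ξ : EuclideanSpace ℝ (Fin N), ξ ≠ 0 → 0 < H ξ)
    (hhom : ∀ ξ : EuclideanSpace ℝ (Fin N), ξ ≠ 0 → ∀ s : ℝ, H (s • ξ) = |s| * H ξ) :
    (∃ Λ : ℝ, 0 < Λ ∧ ∀ ξ : EuclideanSpace ℝ (Fin N), H ξ = 1 →
      ∀ v : EuclideanSpace ℝ (Fin N), ⟪gradient H ξ, v⟫ = 0 →
        Λ * ‖v‖ ^ 2 ≤ ⟪fderiv ℝ (gradient H) ξ v, v⟫) ↔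
    (∃ lam : ℝ, 0 < lam ∧ ∀ ξ : EuclideanSpace ℝ (Fin N), ξ ≠ 0 →
      ∀ η : EuclideanSpace ℝ (Fin N),
        lam * ‖η‖ ^ 2 ≤ ⟪fderiv ℝ (gradient (fun x => H x ^ 2)) ξ η, η⟫) := by
  have hhom' : ∀ y : EuclideanSpace ℝ (Fin N), y ≠ 0 → ∀ s : ℝ, 0 < s →
      H (s • y) = s * H y := fun y hy s hs => by rw [hhom y hy, abs_of_pos hs]
  have hC2 : ∀ y : EuclideanSpace ℝ (Fin N), y ≠ 0 → ContDiffAt ℝ 2 H y := fun y hy =>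
    hreg.contDiffAt (isOpen_compl_singleton.mem_nhds hy)
  have hne : ∀ y : EuclideanSpace ℝ (Fin N), H y = 1 → y ≠ 0 := by
    have : NeZero N := ⟨by omega⟩
    obtain ⟨z, hz⟩ := exists_ne (0 : EuclideanSpace ℝ (Fin N))
    have h0 : H 0 = 0 := by simpa using hhom z hz 0
    rintro y hy rfl
    simp [h0] at hy
  constructor
  · rintro ⟨Λ, hΛ, hell⟩
    obtain ⟨C, hC, hCle⟩ := exists_norm_le_mul_of_homogeneous hhom' hreg.continuousOn hpos
    refine ⟨min (C⁻¹ ^ 2) Λ, by positivity, fun ξ hξ η => ?_⟩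
    have hs : 0 < (H ξ)⁻¹ := inv_pos.2 (hpos ξ hξ)
    have hξ' : (H ξ)⁻¹ • ξ ≠ 0 := smul_ne_zero hs.ne' hξ
    have hH : H ((H ξ)⁻¹ • ξ) = 1 := by
      rw [hhom' ξ hξ _ hs, inv_mul_cancel₀ (hpos ξ hξ).ne']
    have h := le_inner_fderiv_gradient_sq_of_homogeneous hhom' hξ' (hC2 _ hξ') hH hC hΛ
      (by simpa [hH] using hCle _ hξ') (hell _ hH) η
    rw [inner_fderiv_gradient_sq (hC2 _ hξ'), gradient_smul_of_homogeneous hhom' hξ hs, hH] at h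
    rw [inner_fderiv_gradient_sq (hC2 ξ hξ),
      ← fderiv_gradient_smul_of_homogeneous hhom' hξ hs, smul_apply,
      real_inner_smul_left, mul_assoc 2 (H ξ), mul_inv_cancel_left₀ (hpos ξ hξ).ne']
    linarith
  · rintro ⟨lam, hlam, hconv⟩
    refine ⟨lam / 2, half_pos hlam, fun ξ hξ v hv => ?_⟩
    have h := hconv ξ (hne ξ hξ) v
    rw [inner_fderiv_gradient_sq (hC2 ξ (hne ξ hξ)), hv, hξ] at h
    linarith
end
end

section
/- Strong monotonicity of the anisotropic p-Laplacian vector field: there exists a constant C₁ > 0, depending only on p and H, such that for all η, η' ∈ ℝ^N with |η| + |η'| > 0 one has ⟨H^{p−1}(η)∇H(η) − H^{p−1}(η')∇H(η'), η − η'⟩ ≥ C₁ (|η| + |η'|)^{p−2} |η − η'|², where the term H^{p−1}(ζ)∇H(ζ) is understood to be 0 when ζ = 0. -/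
open scoped RealInnerProductSpace Classical
open Metric Set MeasureTheory

noncomputable section

/-- `H : ℝ^N → ℝ` is a Finsler norm: it is `C²` away from the origin, positive away from
the origin, absolutely `1`-homogeneous, and uniformly elliptic (the unit ball
`{H < 1}` is uniformly convex). Here the gradient and the Hessian of `H` are expressed via
`gradient H` and `fderiv ℝ (gradient H)`. -/
def IsFinslerNorm {N : ℕ} (H : EuclideanSpace ℝ (Fin N) → ℝ) : Prop :=
  ContDiffOn ℝ 2 H {(0 : EuclideanSpace ℝ (Fin N))}ᶜ ∧
  (∀ ξ : EuclideanSpace ℝ (Fin N), ξ ≠ 0 → 0 < H ξ) ∧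
  (∀ ξ : EuclideanSpace ℝ (Fin N), ξ ≠ 0 → ∀ s : ℝ, H (s • ξ) = |s| * H ξ) ∧
  (∃ Λ : ℝ, 0 < Λ ∧ ∀ ξ : EuclideanSpace ℝ (Fin N), H ξ = 1 →
    ∀ v : EuclideanSpace ℝ (Fin N), ⟪gradient H ξ, v⟫ = 0 →
      Λ * ‖v‖ ^ 2 ≤ ⟪fderiv ℝ (gradient H) ξ v, v⟫)

/-- The vector field `ζ ↦ H^{p-1}(ζ) ∇H(ζ)` of the anisotropic `p`-Laplacian, understood
to vanish at `ζ = 0`. -/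
def pLaplaceField {N : ℕ} (H : EuclideanSpace ℝ (Fin N) → ℝ) (p : ℝ)
    (ζ : EuclideanSpace ℝ (Fin N)) : EuclideanSpace ℝ (Fin N) :=
  if ζ = 0 then 0 else H ζ ^ (p - 1) • gradient H ζ

namespace IsFinslerNorm

open Filter Topology

variable {N : ℕ} {H : EuclideanSpace ℝ (Fin N) → ℝ} {p : ℝ} {x v : EuclideanSpace ℝ (Fin N)}

theorem pos (hH : IsFinslerNorm H) (hx : x ≠ 0) : 0 < H x := hH.2.1 x hx

theorem contDiffAt (hH : IsFinslerNorm H) (hx : x ≠ 0) : ContDiffAt ℝ 2 H x :=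
  hH.1.contDiffAt (isOpen_compl_singleton.mem_nhds hx)

theorem contDiffAt_gradient (hH : IsFinslerNorm H) (hx : x ≠ 0) :
    ContDiffAt ℝ 1 (gradient H) x := by
  have h : ContDiffAt ℝ 1 (fderiv ℝ H) x := (hH.contDiffAt hx).fderiv_right (by norm_num)
  exact (InnerProductSpace.toDual ℝ
    (EuclideanSpace ℝ (Fin N))).symm.toContinuousLinearEquiv.contDiff.contDiffAt.comp x h

theorem apply_smul (hH : IsFinslerNorm H) (hx : x ≠ 0) {s : ℝ} (hs : 0 < s) :
    H (s • x) = s * H x := by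
  rw [hH.2.2.1 x hx, abs_of_pos hs]

/-- The gradient of a Finsler norm is positively homogeneous of degree zero. -/
theorem gradient_smul (hH : IsFinslerNorm H) (hx : x ≠ 0) {s : ℝ} (hs : 0 < s) :
    gradient H (s • x) = gradient H x := by
  have h : (fun y ↦ H (s • y)) =ᶠ[𝓝 x] fun y ↦ s • H y := by
    filter_upwards [isOpen_compl_singleton.mem_nhds hx] with y hy
    exact hH.apply_smul hy hs
  have h' := h.fderiv_eq (𝕜 := ℝ)
  rw [fderiv_comp_smul, fderiv_fun_const_smul ((hH.contDiffAt hx).differentiableAt two_ne_zero)]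
    at h'
  rw [gradient, gradient, smul_right_injective _ hs.ne' h']

/-- The Hessian of a Finsler norm is positively homogeneous of degree `-1`. -/
theorem smul_fderiv_gradient_smul (hH : IsFinslerNorm H) (hx : x ≠ 0) {s : ℝ} (hs : 0 < s) :
    s • fderiv ℝ (gradient H) (s • x) = fderiv ℝ (gradient H) x := by
  have h : (fun y ↦ gradient H (s • y)) =ᶠ[𝓝 x] gradient H := by
    filter_upwards [isOpen_compl_singleton.mem_nhds hx] with y hy
    exact hH.gradient_smul hy hs
  rw [← fderiv_comp_smul, h.fderiv_eq]

theorem hasFDerivAt (hH : IsFinslerNorm H) (hx : x ≠ 0) : HasFDerivAt H (fderiv ℝ H x) x :=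
  ((hH.contDiffAt hx).differentiableAt two_ne_zero).hasFDerivAt

theorem hasFDerivAt_gradient (hH : IsFinslerNorm H) (hx : x ≠ 0) :
    HasFDerivAt (gradient H) (fderiv ℝ (gradient H) x) x :=
  ((hH.contDiffAt_gradient hx).differentiableAt one_ne_zero).hasFDerivAt

/-- Euler's identity. -/
theorem inner_gradient_self (hH : IsFinslerNorm H) (hx : x ≠ 0) : ⟪gradient H x, x⟫ = H x := by
  rw [inner_gradient_left]
  have h₁ : HasDerivAt (fun s : ℝ ↦ s • x) x 1 := by
    simpa using (hasDerivAt_id (1 : ℝ)).smul_const x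
  have h₂ : HasDerivAt (fun s : ℝ ↦ H (s • x)) (fderiv ℝ H x x) 1 :=
    HasFDerivAt.comp_hasDerivAt 1 (by simpa using hH.hasFDerivAt hx) h₁
  have h₃ : HasDerivAt (fun s : ℝ ↦ H (s • x)) (H x) 1 := by
    have h : HasDerivAt (fun s : ℝ ↦ s * H x) (H x) 1 := by
      simpa using (hasDerivAt_id (1 : ℝ)).mul_const (H x)
    refine h.congr_of_eventuallyEq ?_
    filter_upwards [Ioi_mem_nhds one_pos] with s hs
    exact hH.apply_smul hx hs
  exact h₂.unique h₃

theorem fderiv_gradient_self (hH : IsFinslerNorm H) (hx : x ≠ 0) :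
    fderiv ℝ (gradient H) x x = 0 := by
  have h₁ : HasDerivAt (fun s : ℝ ↦ s • x) x 1 := by
    simpa using (hasDerivAt_id (1 : ℝ)).smul_const x
  have h₂ : HasDerivAt (fun s : ℝ ↦ gradient H (s • x)) (fderiv ℝ (gradient H) x x) 1 :=
    HasFDerivAt.comp_hasDerivAt (l := gradient H) 1
      (by simpa using hH.hasFDerivAt_gradient hx) h₁
  have h₃ : HasDerivAt (fun s : ℝ ↦ gradient H (s • x)) 0 1 := by
    refine (hasDerivAt_const (1 : ℝ) (gradient H x)).congr_of_eventuallyEq ?_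
    filter_upwards [Ioi_mem_nhds one_pos] with s hs
    exact hH.gradient_smul hx hs
  exact h₂.unique h₃

theorem inner_fderiv_gradient_self (hH : IsFinslerNorm H) (hx : x ≠ 0)
    (v : EuclideanSpace ℝ (Fin N)) : ⟪fderiv ℝ (gradient H) x v, x⟫ = 0 := by
  have h₁ := (hH.hasFDerivAt_gradient hx).inner ℝ (hasFDerivAt_id x)
  have h₂ : (fun y ↦ ⟪gradient H y, id y⟫) =ᶠ[𝓝 x] H := by
    filter_upwards [isOpen_compl_singleton.mem_nhds hx] with y hy
    exact hH.inner_gradient_self hy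
  have h₃ := congrArg (fun L ↦ L v)
    (h₁.unique ((hH.hasFDerivAt hx).congr_of_eventuallyEq h₂))
  simpa [inner_gradient_left] using h₃

/-- The Hessian is positive definite on the hyperplane orthogonal to the gradient. -/
theorem inner_fderiv_gradient_pos (hH : IsFinslerNorm H) (hx : x ≠ 0) (hv : v ≠ 0)
    (hxv : ⟪gradient H x, v⟫ = 0) : 0 < ⟪fderiv ℝ (gradient H) x v, v⟫ := by
  obtain ⟨Λ, hΛ, h⟩ := hH.2.2.2
  have hs : 0 < (H x)⁻¹ := inv_pos.2 (hH.pos hx)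
  have h' := h ((H x)⁻¹ • x)
    (by rw [hH.apply_smul hx hs, inv_mul_cancel₀ (hH.pos hx).ne']) v
    (by rw [hH.gradient_smul hx hs, hxv])
  rw [← hH.smul_fderiv_gradient_smul hx hs, smul_apply, real_inner_smul_left]
  have : 0 < ‖v‖ := norm_pos_iff.2 hv
  exact mul_pos hs (lt_of_lt_of_le (by positivity) h')

theorem inner_fderiv_gradient_decomp (hH : IsFinslerNorm H) (hx : x ≠ 0) (α : ℝ)
    (w : EuclideanSpace ℝ (Fin N)) :
    ⟪fderiv ℝ (gradient H) x (α • x + w), α • x + w⟫ = ⟪fderiv ℝ (gradient H) x w, w⟫ := by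
  rw [map_add, map_smul, hH.fderiv_gradient_self hx, smul_zero, zero_add, inner_add_right,
    real_inner_smul_right, hH.inner_fderiv_gradient_self hx, mul_zero, zero_add]

theorem pLaplaceField_eventuallyEq (hx : x ≠ 0) :
    pLaplaceField H p =ᶠ[𝓝 x] fun y ↦ H y ^ (p - 1) • gradient H y := by
  filter_upwards [isOpen_compl_singleton.mem_nhds hx] with y hy
  exact if_neg hy

theorem contDiffAt_pLaplaceField (hH : IsFinslerNorm H) (hx : x ≠ 0) :
    ContDiffAt ℝ 1 (pLaplaceField H p) x :=
  ((((hH.contDiffAt hx).of_le one_le_two).rpow_const_of_ne (hH.pos hx).ne').smul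
    (hH.contDiffAt_gradient hx)).congr_of_eventuallyEq (pLaplaceField_eventuallyEq hx)

theorem hasStrictFDerivAt_pLaplaceField (hH : IsFinslerNorm H) (hx : x ≠ 0) :
    HasStrictFDerivAt (pLaplaceField H p) (fderiv ℝ (pLaplaceField H p) x) x :=
  (hH.contDiffAt_pLaplaceField hx).hasStrictFDerivAt one_ne_zero

theorem inner_fderiv_pLaplaceField (hH : IsFinslerNorm H) (hx : x ≠ 0)
    (v : EuclideanSpace ℝ (Fin N)) :
    ⟪fderiv ℝ (pLaplaceField H p) x v, v⟫ =
      H x ^ (p - 1) * ⟪fderiv ℝ (gradient H) x v, v⟫ +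
        (p - 1) * H x ^ (p - 1 - 1) * ⟪gradient H x, v⟫ ^ 2 := by
  have h := ((hH.hasFDerivAt hx).rpow_const (p := p - 1) (Or.inl (hH.pos hx).ne')).smul
    (hH.hasFDerivAt_gradient hx)
  rw [(h.congr_of_eventuallyEq (pLaplaceField_eventuallyEq hx)).fderiv]
  simp only [add_apply, smul_apply,
    ContinuousLinearMap.smulRight_apply, inner_add_left, real_inner_smul_left, smul_eq_mul,
    inner_gradient_left]
  ring

/-- The derivative of the `p`-Laplacian field is positive definite away from the origin. -/
theorem inner_fderiv_pLaplaceField_pos (hH : IsFinslerNorm H) (hp : 1 < p) (hx : x ≠ 0)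
    (hv : v ≠ 0) : 0 < ⟪fderiv ℝ (pLaplaceField H p) x v, v⟫ := by
  rw [hH.inner_fderiv_pLaplaceField hx]
  have hHx := hH.pos hx
  have h₁ : 0 < H x ^ (p - 1) := Real.rpow_pos_of_pos hHx _
  have h₂ : 0 < (p - 1) * H x ^ (p - 1 - 1) :=
    mul_pos (sub_pos.2 hp) (Real.rpow_pos_of_pos hHx _)
  set α := ⟪gradient H x, v⟫ / H x with hα
  obtain ⟨w, hw⟩ : ∃ w, v = α • x + w := ⟨v - α • x, by abel⟩
  have hgw : ⟪gradient H x, w⟫ = 0 := by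
    have h : w = v - α • x := by rw [hw]; abel
    rw [h, inner_sub_right, real_inner_smul_right, hH.inner_gradient_self hx, hα,
      div_mul_cancel₀ _ hHx.ne', sub_self]
  have hvw : ⟪fderiv ℝ (gradient H) x v, v⟫ = ⟪fderiv ℝ (gradient H) x w, w⟫ := by
    conv_lhs => rw [hw]
    exact hH.inner_fderiv_gradient_decomp hx α w
  rw [hvw]
  by_cases hw0 : w = 0
  · have hg : ⟪gradient H x, v⟫ ≠ 0 := by
      intro h
      rw [h, zero_div] at hα
      exact hv (by rw [hw, hα, hw0]; simp)
    rw [hw0, inner_zero_right, mul_zero, zero_add]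
    positivity
  · have := hH.inner_fderiv_gradient_pos hx hw0 hgw
    positivity

theorem pLaplaceField_smul (hH : IsFinslerNorm H) {s : ℝ} (hs : 0 < s)
    (x : EuclideanSpace ℝ (Fin N)) :
    pLaplaceField H p (s • x) = s ^ (p - 1) • pLaplaceField H p x := by
  by_cases hx : x = 0
  · simp [pLaplaceField, hx]
  · rw [pLaplaceField, pLaplaceField, if_neg hx, if_neg (smul_ne_zero hs.ne' hx),
      hH.apply_smul hx hs, hH.gradient_smul hx hs, Real.mul_rpow hs.le (hH.pos hx).le, smul_smul]

theorem inner_pLaplaceField_self_pos (hH : IsFinslerNorm H) (hx : x ≠ 0) :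
    0 < ⟪pLaplaceField H p x, x⟫ := by
  rw [pLaplaceField, if_neg hx, real_inner_smul_left, hH.inner_gradient_self hx]
  exact mul_pos (Real.rpow_pos_of_pos (hH.pos hx) _) (hH.pos hx)

theorem continuous_pLaplaceField (hH : IsFinslerNorm H) (hp : 1 < p) :
    Continuous (pLaplaceField H p) := by
  rw [continuous_iff_continuousAt]
  intro x
  by_cases hx : x = 0
  swap
  · exact (hH.contDiffAt_pLaplaceField hx).continuousAt
  subst hx
  have hne : ∀ y ∈ sphere (0 : EuclideanSpace ℝ (Fin N)) 1, y ≠ 0 := fun y hy ↦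
    ne_zero_of_mem_unit_sphere ⟨y, hy⟩
  obtain ⟨C, hC⟩ := (isCompact_sphere (0 : EuclideanSpace ℝ (Fin N)) 1).exists_bound_of_continuousOn
    (f := pLaplaceField H p)
    fun y hy ↦ (hH.contDiffAt_pLaplaceField (hne y hy)).continuousAt.continuousWithinAt
  have h0 : pLaplaceField H p 0 = 0 := if_pos rfl
  have hbound : ∀ y, ‖pLaplaceField H p y‖ ≤ ‖y‖ ^ (p - 1) * C := by
    intro y
    by_cases hy : y = 0
    · simp [hy, h0, Real.zero_rpow (sub_pos.2 hp).ne']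
    · have hy' : 0 < ‖y‖ := norm_pos_iff.2 hy
      have h := hH.pLaplaceField_smul (p := p) hy' (‖y‖⁻¹ • y)
      rw [smul_inv_smul₀ hy'.ne'] at h
      rw [h, norm_smul, Real.norm_of_nonneg (by positivity)]
      gcongr
      exact hC _ (by simp [norm_smul, hy'.ne'])
  rw [ContinuousAt, h0]
  refine squeeze_zero_norm hbound ?_
  have hcont : Continuous fun y : EuclideanSpace ℝ (Fin N) ↦ ‖y‖ ^ (p - 1) * C :=
    (continuous_norm.rpow_const fun _ ↦ Or.inr (sub_pos.2 hp).le).mul continuous_const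
  simpa [Real.zero_rpow (sub_pos.2 hp).ne'] using hcont.tendsto 0

/-- Strict monotonicity of the `p`-Laplacian field. -/
theorem inner_pLaplaceField_sub_pos (hH : IsFinslerNorm H) (hp : 1 < p)
    {a b : EuclideanSpace ℝ (Fin N)} (hab : a ≠ b) :
    0 < ⟪pLaplaceField H p a - pLaplaceField H p b, a - b⟫ := by
  have hV := hH.continuous_pLaplaceField hp
  by_cases h0 : ∃ t ∈ Ioo (0 : ℝ) 1, b + t • (a - b) = 0
  · obtain ⟨t, ⟨ht0, ht1⟩, ht⟩ := h0
    have hb : b = (-t) • (a - b) := by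
      rw [neg_smul]; exact eq_neg_of_add_eq_zero_left ht
    have ha : a = (1 - t) • (a - b) := by
      rw [sub_smul, one_smul, sub_eq_add_neg, ← neg_smul, ← hb]; abel
    have hd : a - b ≠ 0 := sub_ne_zero.2 hab
    have h₁ := hH.inner_pLaplaceField_self_pos (p := p) (x := a)
      (by rw [ha]; exact smul_ne_zero (by linarith) hd)
    have h₂ := hH.inner_pLaplaceField_self_pos (p := p) (x := b)
      (by rw [hb]; exact smul_ne_zero (by linarith) hd)
    have e₁ : ⟪pLaplaceField H p a, a⟫ = (1 - t) * ⟪pLaplaceField H p a, a - b⟫ := by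
      rw [← real_inner_smul_right, ← ha]
    have e₂ : ⟪pLaplaceField H p b, b⟫ = -t * ⟪pLaplaceField H p b, a - b⟫ := by
      rw [← real_inner_smul_right, ← hb]
    rw [inner_sub_left]
    have h₃ : 0 < ⟪pLaplaceField H p a, a - b⟫ :=
      pos_of_mul_pos_right (e₁ ▸ h₁) (by linarith)
    nlinarith
  · push Not at h0
    set g : ℝ → ℝ := fun t ↦ ⟪pLaplaceField H p (b + t • (a - b)), a - b⟫ with hg
    have hmono : StrictMonoOn g (Icc 0 1) := by
      refine strictMonoOn_of_deriv_pos (convex_Icc 0 1) (by fun_prop) fun t ht ↦ ?_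
      rw [interior_Icc] at ht
      have h₁ : HasDerivAt (fun s : ℝ ↦ b + s • (a - b)) (a - b) t := by
        simpa using ((hasDerivAt_id t).smul_const (a - b)).const_add b
      have h₂ := (hH.hasStrictFDerivAt_pLaplaceField (p := p) (h0 t ht)).hasFDerivAt.comp_hasDerivAt
        t h₁
      have h₃ := h₂.inner ℝ (hasDerivAt_const t (a - b))
      have h₄ : HasDerivAt g
          ⟪fderiv ℝ (pLaplaceField H p) (b + t • (a - b)) (a - b), a - b⟫ t := by
        simpa using h₃
      rw [h₄.deriv]
      exact hH.inner_fderiv_pLaplaceField_pos hp (h0 t ht) (sub_ne_zero.2 hab)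
    have h := hmono (left_mem_Icc.2 zero_le_one) (right_mem_Icc.2 zero_le_one) one_pos
    rw [inner_sub_left]
    simpa [hg] using h

theorem exists_inner_fderiv_pLaplaceField_ge (hH : IsFinslerNorm H) (hp : 1 < p) (hx : x ≠ 0) :
    ∃ c : ℝ, 0 < c ∧ ∀ v, c * ‖v‖ ^ 2 ≤ ⟪fderiv ℝ (pLaplaceField H p) x v, v⟫ := by
  obtain ⟨c, hc, h⟩ := (isCompact_sphere (0 : EuclideanSpace ℝ (Fin N)) 1).exists_forall_le'
    (f := fun v ↦ ⟪fderiv ℝ (pLaplaceField H p) x v, v⟫) (a := 0) (by fun_prop)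
    fun v hv ↦ hH.inner_fderiv_pLaplaceField_pos hp hx (ne_zero_of_mem_unit_sphere ⟨v, hv⟩)
  refine ⟨c, hc, fun v ↦ ?_⟩
  by_cases hv : v = 0
  · simp [hv]
  have hv' : 0 < ‖v‖ := norm_pos_iff.2 hv
  have h' := h (‖v‖⁻¹ • v) (by simp [norm_smul, hv'.ne'])
  simp only [map_smul, real_inner_smul_left, real_inner_smul_right] at h'
  calc c * ‖v‖ ^ 2 ≤ ‖v‖⁻¹ * (‖v‖⁻¹ * ⟪fderiv ℝ (pLaplaceField H p) x v, v⟫) * ‖v‖ ^ 2 := by gcongr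
    _ = ⟪fderiv ℝ (pLaplaceField H p) x v, v⟫ := by field_simp

/-- Strong monotonicity of the `p`-Laplacian field near a nonzero point. -/
theorem exists_eventually_inner_pLaplaceField_sub_ge (hH : IsFinslerNorm H) (hp : 1 < p)
    (hx : x ≠ 0) :
    ∃ c : ℝ, 0 < c ∧ ∀ᶠ q : EuclideanSpace ℝ (Fin N) × EuclideanSpace ℝ (Fin N) in 𝓝 (x, x),
      c * ‖q.1 - q.2‖ ^ 2 ≤ ⟪pLaplaceField H p q.1 - pLaplaceField H p q.2, q.1 - q.2⟫ := by
  obtain ⟨c, hc, h⟩ := hH.exists_inner_fderiv_pLaplaceField_ge hp hx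
  refine ⟨c / 2, half_pos hc, ?_⟩
  filter_upwards [(hH.hasStrictFDerivAt_pLaplaceField (p := p) hx).isLittleO.def (half_pos hc)]
    with q hq
  set L := fderiv ℝ (pLaplaceField H p) x
  set r := pLaplaceField H p q.1 - pLaplaceField H p q.2 - L (q.1 - q.2) with hr
  have e : pLaplaceField H p q.1 - pLaplaceField H p q.2 = L (q.1 - q.2) + r := by
    rw [hr]; abel
  rw [e, inner_add_left]
  have h₁ := h (q.1 - q.2)
  have h₂ := (abs_le.1 (abs_real_inner_le_norm r (q.1 - q.2))).1
  have h₃ := mul_le_mul_of_nonneg_right hq (norm_nonneg (q.1 - q.2))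
  nlinarith

/-- Strong monotonicity of the `p`-Laplacian field for pairs with `‖x‖ + ‖y‖ = 1`. -/
theorem exists_inner_pLaplaceField_sub_ge (hH : IsFinslerNorm H) (hp : 1 < p) :
    ∃ c : ℝ, 0 < c ∧
      ∀ q ∈ {q : EuclideanSpace ℝ (Fin N) × EuclideanSpace ℝ (Fin N) | ‖q.1‖ + ‖q.2‖ = 1},
      c * ‖q.1 - q.2‖ ^ 2 ≤ ⟪pLaplaceField H p q.1 - pLaplaceField H p q.2, q.1 - q.2⟫ := by
  have hV := hH.continuous_pLaplaceField hp
  have hK : IsCompact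
      {q : EuclideanSpace ℝ (Fin N) × EuclideanSpace ℝ (Fin N) | ‖q.1‖ + ‖q.2‖ = 1} := by
    refine (isCompact_closedBall 0 1).of_isClosed_subset
      (isClosed_eq (by fun_prop) (by fun_prop)) fun q hq ↦ ?_
    rw [mem_ofPred_eq] at hq
    rw [mem_closedBall_zero_iff, Prod.norm_def, sup_le_iff]
    constructor <;> linarith [norm_nonneg q.1, norm_nonneg q.2]
  refine hK.induction_on (p := fun S ↦ ∃ c : ℝ, 0 < c ∧ ∀ q ∈ S,
    c * ‖q.1 - q.2‖ ^ 2 ≤ ⟪pLaplaceField H p q.1 - pLaplaceField H p q.2, q.1 - q.2⟫)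
    ⟨1, one_pos, by simp⟩ ?_ ?_ ?_
  · rintro S T hST ⟨c, hc, h⟩
    exact ⟨c, hc, fun q hq ↦ h q (hST hq)⟩
  · rintro S T ⟨c, hc, h⟩ ⟨d, hd, h'⟩
    refine ⟨min c d, lt_min hc hd, fun q hq ↦ ?_⟩
    rcases hq with hq | hq
    · exact le_trans (by gcongr; exact min_le_left c d) (h q hq)
    · exact le_trans (by gcongr; exact min_le_right c d) (h' q hq)
  rintro ⟨a, b⟩ hab
  by_cases hne : a = b
  · subst hne
    have ha : a ≠ 0 := by
      rintro rfl
      simp at hab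
    obtain ⟨c, hc, h⟩ := hH.exists_eventually_inner_pLaplaceField_sub_ge hp ha
    exact ⟨_, mem_nhdsWithin_of_mem_nhds h, c, hc, fun q hq ↦ hq⟩
  · have hpos := hH.inner_pLaplaceField_sub_pos hp hne
    set m := ⟪pLaplaceField H p a - pLaplaceField H p b, a - b⟫
    have hcont : Continuous fun q : EuclideanSpace ℝ (Fin N) × EuclideanSpace ℝ (Fin N) ↦
        ⟪pLaplaceField H p q.1 - pLaplaceField H p q.2, q.1 - q.2⟫ := by fun_prop
    have hev : ∀ᶠ q : EuclideanSpace ℝ (Fin N) × EuclideanSpace ℝ (Fin N) in 𝓝 (a, b),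
        m / 2 < ⟪pLaplaceField H p q.1 - pLaplaceField H p q.2, q.1 - q.2⟫ :=
      (hcont.tendsto (a, b)).eventually_const_lt (half_lt_self hpos)
    refine ⟨_, inter_mem (mem_nhdsWithin_of_mem_nhds hev) self_mem_nhdsWithin, m / 2,
      half_pos hpos, fun q hq ↦ ?_⟩
    have hq₁ : m / 2 < ⟪pLaplaceField H p q.1 - pLaplaceField H p q.2, q.1 - q.2⟫ := hq.1
    have hq₂ : ‖q.1‖ + ‖q.2‖ = 1 := hq.2
    have hle : ‖q.1 - q.2‖ ^ 2 ≤ 1 :=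
      pow_le_one₀ (norm_nonneg _) ((norm_sub_le _ _).trans hq₂.le)
    nlinarith

end IsFinslerNorm

/-- Strong monotonicity of the anisotropic `p`-Laplacian vector field: there is
`C₁ > 0`, depending only on `p` and `H`, with
`⟨H^{p-1}(η)∇H(η) − H^{p-1}(η')∇H(η'), η − η'⟩ ≥ C₁ (|η|+|η'|)^{p-2} |η−η'|²`
whenever `|η| + |η'| > 0`. -/
theorem pLaplaceField_strong_monotonicity {N : ℕ} (hN : 2 ≤ N) (p : ℝ) (hp : 1 < p)
    (H : EuclideanSpace ℝ (Fin N) → ℝ) (hH : IsFinslerNorm H) :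
    ∃ C₁ : ℝ, 0 < C₁ ∧ ∀ η η' : EuclideanSpace ℝ (Fin N), 0 < ‖η‖ + ‖η'‖ →
      C₁ * (‖η‖ + ‖η'‖) ^ (p - 2) * ‖η - η'‖ ^ 2 ≤
        ⟪pLaplaceField H p η - pLaplaceField H p η', η - η'⟫ := by
  obtain ⟨c, hc, h⟩ := hH.exists_inner_pLaplaceField_sub_ge hp
  refine ⟨c, hc, fun η η' hr ↦ ?_⟩
  set r := ‖η‖ + ‖η'‖ with hr_def
  clear_value r
  obtain ⟨x, rfl⟩ : ∃ x, η = r • x := ⟨r⁻¹ • η, (smul_inv_smul₀ hr.ne' η).symm⟩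
  obtain ⟨y, rfl⟩ : ∃ y, η' = r • y := ⟨r⁻¹ • η', (smul_inv_smul₀ hr.ne' η').symm⟩
  have hxy : ‖x‖ + ‖y‖ = 1 := by
    rw [norm_smul, norm_smul, Real.norm_of_nonneg hr.le, ← mul_add] at hr_def
    exact mul_left_cancel₀ hr.ne' (by rw [← hr_def, mul_one])
  have hpow : r ^ (p - 1) = r ^ (p - 2) * r := by
    rw [← Real.rpow_add_one hr.ne']; ring_nf
  rw [hH.pLaplaceField_smul hr, hH.pLaplaceField_smul hr, ← smul_sub, ← smul_sub,
    real_inner_smul_left, real_inner_smul_right, norm_smul, Real.norm_of_nonneg hr.le, hpow]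
  calc c * r ^ (p - 2) * (r * ‖x - y‖) ^ 2
      = r ^ (p - 2) * r * (r * (c * ‖x - y‖ ^ 2)) := by ring
    _ ≤ _ := by gcongr; exact h (x, y) hxy
end
end
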